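/- Let 1 < p < ∞, let W be a matrix A_p weight on ℝ^d with reducing operators V_I, and let 𝒥 be the stopping time where 𝒥(I) consists of the maximal dyadic subcubes J of I with ‖V_J V_I^{−1}‖^p > λ₁ or ‖V_J^{−1} V_I‖^{p'} > λ₂, with λ₁, λ₂ chosen as in the decay lemma (λ₁ depending only on n, d, p and λ₂ ≈ ‖W‖_{A_p}^{p'/p}). For I ∈ 𝒟 define M_I f⃗ := ∑_{J ∈ ℱ(I)} ∑_{ε ∈ 𝒮} V_J^{−1} f⃗_J^ε h_J^ε. Then for every f⃗ with finite Haar expansion, ‖V_I M_I f⃗‖_{L^p}^p ≤ C ‖W‖_{A_p} ‖f⃗‖_{L^p}^p, where C depends only on p, n, d. -/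

import Mathlib

open MeasureTheory ENNReal
open scoped ComplexOrder

noncomputable section

/-! ## Basic linear-algebra notation -/

/-- The operator norm of an `n × n` complex matrix, viewed as an operator on the
Euclidean space `ℂⁿ`. -/
def matNorm {n : ℕ} (M : Matrix (Fin n) (Fin n) ℂ) : ℝ :=
  ‖Matrix.toEuclideanCLM (𝕜 := ℂ) (n := Fin n) M‖

/-- A matrix applied to a vector of `ℂⁿ` (with its Euclidean norm). -/
def mApp {n : ℕ} (M : Matrix (Fin n) (Fin n) ℂ) (v : EuclideanSpace ℂ (Fin n)) :
    EuclideanSpace ℂ (Fin n) :=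
  Matrix.toEuclideanCLM (𝕜 := ℂ) (n := Fin n) M v


/-- Entrywise measurability of a matrix-valued function. -/
def MatMeasurable {d n : ℕ} (W : (Fin d → ℝ) → Matrix (Fin n) (Fin n) ℂ) : Prop :=
  ∀ i j, Measurable fun x => W x i j

/-! ## Dyadic cubes and Haar functions -/

/-- A dyadic cube in `ℝ^d`, with side length `2^k` and lower-left corner `(m i * 2^k)_i`. -/
structure DCube (d : ℕ) where
  k : ℤ
  m : Fin d → ℤ

namespace DCube

variable {d : ℕ}

/-- The (half-open) cube in `ℝ^d` determined by a dyadic cube. -/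
def set (I : DCube d) : Set (Fin d → ℝ) :=
  {x | ∀ i, (I.m i : ℝ) * 2 ^ I.k ≤ x i ∧ x i < ((I.m i : ℝ) + 1) * 2 ^ I.k}

/-- The volume `|I| = (2^k)^d` of a dyadic cube. -/
def vol (I : DCube d) : ℝ := ((2 : ℝ) ^ I.k) ^ d

/-- The lower-left corner of a dyadic cube. -/
def corner (I : DCube d) : Fin d → ℝ := fun i => (I.m i : ℝ) * 2 ^ I.k

/-- The side length of a dyadic cube. -/
def side (I : DCube d) : ℝ := (2 : ℝ) ^ I.k

end DCube

/-- One-dimensional Haar functions on the dyadic interval `[m·2^k, (m+1)·2^k)`: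
`haar1D true` is the non-cancellative `|I|^{-1/2} χ_I`, while `haar1D false` is
`|I|^{-1/2} (χ_{I_ℓ} - χ_{I_r})`. -/
def haar1D (ε : Bool) (k mm : ℤ) (t : ℝ) : ℝ :=
  if ε then
    Set.indicator {s : ℝ | (mm : ℝ) * 2 ^ k ≤ s ∧ s < ((mm : ℝ) + 1) * 2 ^ k}
      (fun _ => ((2 : ℝ) ^ k) ^ (-(1 / 2 : ℝ))) t
  else
    Set.indicator {s : ℝ | (mm : ℝ) * 2 ^ k ≤ s ∧ s < (mm : ℝ) * 2 ^ k + 2 ^ (k - 1)}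
      (fun _ => ((2 : ℝ) ^ k) ^ (-(1 / 2 : ℝ))) t -
    Set.indicator {s : ℝ | (mm : ℝ) * 2 ^ k + 2 ^ (k - 1) ≤ s ∧ s < ((mm : ℝ) + 1) * 2 ^ k}
      (fun _ => ((2 : ℝ) ^ k) ^ (-(1 / 2 : ℝ))) t

/-- The signature set `𝒮 = {0,1}^d \ {(1,…,1)}` indexing the cancellative Haar functions. -/
def Sfin (d : ℕ) : Finset (Fin d → Bool) := Finset.univ.erase (fun _ => true)

/-- The Haar function `h_I^ε = ∏ i, h_{I_i}^{ε_i}` associated to a dyadic cube `I ⊂ ℝ^d`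
and a signature `ε ∈ {0,1}^d`. -/
def haarFn {d : ℕ} (I : DCube d) (ε : Fin d → Bool) (x : Fin d → ℝ) : ℝ :=
  ∏ i, haar1D (ε i) I.k (I.m i) (x i)

/-- The (vector of) Haar coefficients `f_I^ε = ∫ f h_I^ε` of a `ℂⁿ`-valued function. -/
def haarCoef {d n : ℕ} (f : (Fin d → ℝ) → EuclideanSpace ℂ (Fin n)) (I : DCube d)
    (ε : Fin d → Bool) : EuclideanSpace ℂ (Fin n) :=
  ∫ x, haarFn I ε x • f x

/-! ## Matrix `A_p` weights and reducing operators -/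

/-- The (closed, axis-parallel) cube with corner `c` and side length `r`. -/
def cubeSet {d : ℕ} (c : Fin d → ℝ) (r : ℝ) : Set (Fin d → ℝ) :=
  {x | ∀ i, c i ≤ x i ∧ x i ≤ c i + r}

/-- The matrix `A_p` characteristic `‖W‖_{A_p}` of a matrix weight `W`, expressed in terms of
`W1p = W^{1/p}` (so that `W^{-1/p} = (W1p)⁻¹`):
`sup_I (1/|I|) ∫_I ((1/|I|) ∫_I ‖W^{1/p}(x) W^{-1/p}(t)‖^{p'} dt)^{p/p'} dx`,
the supremum being over all cubes `I ⊂ ℝ^d`.  Here `p' = p/(p-1)` and `p/p' = p - 1`. -/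
def apNorm {d n : ℕ} (p : ℝ) (W1p : (Fin d → ℝ) → Matrix (Fin n) (Fin n) ℂ) : ℝ≥0∞ :=
  ⨆ (c : Fin d → ℝ) (r : ℝ) (_ : 0 < r),
    (ENNReal.ofReal (r ^ d))⁻¹ *
      ∫⁻ x in cubeSet c r,
        ((ENNReal.ofReal (r ^ d))⁻¹ *
            ∫⁻ t in cubeSet c r,
              ENNReal.ofReal (matNorm (W1p x * (W1p t)⁻¹)) ^ (p / (p - 1))) ^ (p - 1)

/-- The `L^q` average `(|I|^{-1} ∫_I ‖A(x) e‖^q dx)^{1/q}` over a dyadic cube. -/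
def redAvgD {d n : ℕ} (q : ℝ) (A : (Fin d → ℝ) → Matrix (Fin n) (Fin n) ℂ) (I : DCube d)
    (e : EuclideanSpace ℂ (Fin n)) : ℝ≥0∞ :=
  ((ENNReal.ofReal I.vol)⁻¹ * ∫⁻ x in I.set, ENNReal.ofReal ‖mApp (A x) e‖ ^ q) ^ (1 / q)

/-- `V` is a family of reducing operators for the weight `W = (W1p)^p` (indexed by dyadic
cubes), with comparability constants `c₁, c₂`:  each `V I` is positive definite and
`|V_I e| ≈ (|I|^{-1} ∫_I |W^{1/p}(x) e|^p dx)^{1/p}`. -/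
def IsReducing {d n : ℕ} (p c₁ c₂ : ℝ) (W1p : (Fin d → ℝ) → Matrix (Fin n) (Fin n) ℂ)
    (V : DCube d → Matrix (Fin n) (Fin n) ℂ) : Prop :=
  ∀ I : DCube d, (V I).PosDef ∧ ∀ e : EuclideanSpace ℂ (Fin n),
    ENNReal.ofReal c₁ * redAvgD p W1p I e ≤ ENNReal.ofReal ‖mApp (V I) e‖ ∧
    ENNReal.ofReal ‖mApp (V I) e‖ ≤ ENNReal.ofReal c₂ * redAvgD p W1p I e

/-- `V'` is a family of dual reducing operators for the weight `W = (W1p)^p`: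
`|V_I' e| ≈ (|I|^{-1} ∫_I |W^{-1/p}(x) e|^{p'} dx)^{1/p'}` with `p' = p/(p-1)`. -/
def IsDualReducing {d n : ℕ} (p c₁ c₂ : ℝ) (W1p : (Fin d → ℝ) → Matrix (Fin n) (Fin n) ℂ)
    (V' : DCube d → Matrix (Fin n) (Fin n) ℂ) : Prop :=
  ∀ I : DCube d, (V' I).PosDef ∧ ∀ e : EuclideanSpace ℂ (Fin n),
    ENNReal.ofReal c₁ * redAvgD (p / (p - 1)) (fun x => (W1p x)⁻¹) I e ≤
        ENNReal.ofReal ‖mApp (V' I) e‖ ∧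
    ENNReal.ofReal ‖mApp (V' I) e‖ ≤
        ENNReal.ofReal c₂ * redAvgD (p / (p - 1)) (fun x => (W1p x)⁻¹) I e

/-- The `L^p(W)` norm `(∫ |W^{1/p}(x) f(x)|^p dx)^{1/p}` (as a value in `[0,∞]`). -/
def wNorm {d n : ℕ} (p : ℝ) (W1p : (Fin d → ℝ) → Matrix (Fin n) (Fin n) ℂ)
    (f : (Fin d → ℝ) → EuclideanSpace ℂ (Fin n)) : ℝ≥0∞ :=
  (∫⁻ x, ENNReal.ofReal ‖mApp (W1p x) (f x)‖ ^ p) ^ (1 / p)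

/-- The square-function expression
`∑_{I ∈ 𝒟} ∑_{ε ∈ 𝒮} |A_I f_I^ε|² |I|^{-1} χ_I(x)` for a family of matrices `A_I`. -/
def sqFn {d n : ℕ} (A : DCube d → Matrix (Fin n) (Fin n) ℂ)
    (f : (Fin d → ℝ) → EuclideanSpace ℂ (Fin n)) (x : Fin d → ℝ) : ℝ≥0∞ :=
  ∑' I : DCube d, ∑ ε ∈ Sfin d,
    Set.indicator I.set
      (fun _ => ENNReal.ofReal (‖mApp (A I) (haarCoef f I ε)‖ ^ 2) / ENNReal.ofReal I.vol) x

/-! ## Stopping times -/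

/-- A stopping time assigns to each dyadic cube `I` a collection `𝒥 I` of pairwise disjoint
dyadic subcubes of `I`. -/
def IsStopping {d : ℕ} (𝒥 : DCube d → Set (DCube d)) : Prop :=
  ∀ I : DCube d, (∀ J ∈ 𝒥 I, J.set ⊆ I.set) ∧
    (𝒥 I).Pairwise fun J K => Disjoint J.set K.set

/-- `ℱ(I)`: the dyadic subcubes of `I` not contained in any stopping cube `J ∈ 𝒥(I)`. -/
def Fcol {d : ℕ} (𝒥 : DCube d → Set (DCube d)) (I : DCube d) : Set (DCube d) :=
  {J | J.set ⊆ I.set ∧ ∀ K ∈ 𝒥 I, ¬J.set ⊆ K.set}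

/-- A stopping time is admissible if `I ∈ ℱ(I)` for every `I`. -/
def Admissible {d : ℕ} (𝒥 : DCube d → Set (DCube d)) : Prop :=
  ∀ I : DCube d, I ∈ Fcol 𝒥 I

/-- The iterated stopping collections: `𝒥^0(I) = {I}` and
`𝒥^{j+1}(I) = ⋃_{J ∈ 𝒥^j(I)} 𝒥(J)`. -/
def JIter {d : ℕ} (𝒥 : DCube d → Set (DCube d)) : ℕ → DCube d → Set (DCube d)
  | 0, I => {I}
  | j + 1, I => ⋃ J ∈ JIter 𝒥 j I, 𝒥 J

/-- A stopping time is decaying with constant `c` if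
`∑_{J ∈ 𝒥(I)} |J| ≤ c |I|` for every `I`. -/
def Decaying {d : ℕ} (c : ℝ) (𝒥 : DCube d → Set (DCube d)) : Prop :=
  ∀ I : DCube d,
    ∑' J : 𝒥 I, ENNReal.ofReal (J : DCube d).vol ≤ ENNReal.ofReal c * ENNReal.ofReal I.vol

/-- `ℱ^j = ℱ^j(I₀) = ⋃_{J ∈ 𝒥^{j-1}(I₀)} ℱ(J)` (intended for `j ≥ 1`). -/
def Fj {d : ℕ} (𝒥 : DCube d → Set (DCube d)) (I₀ : DCube d) (j : ℕ) : Set (DCube d) :=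
  ⋃ J ∈ JIter 𝒥 (j - 1) I₀, Fcol 𝒥 J

/-- The Haar projection `Δ_j f = ∑_{I ∈ ℱ^j} ∑_{ε ∈ 𝒮} f_I^ε h_I^ε`. -/
def deltaHaar {d n : ℕ} (𝒥 : DCube d → Set (DCube d)) (I₀ : DCube d) (j : ℕ)
    (f : (Fin d → ℝ) → EuclideanSpace ℂ (Fin n)) (x : Fin d → ℝ) :
    EuclideanSpace ℂ (Fin n) :=
  ∑' I : Fj 𝒥 I₀ j, ∑ ε ∈ Sfin d, haarFn (I : DCube d) ε x • haarCoef f (I : DCube d) ε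

/-! ## Constant Haar multipliers -/

/-- `∑_{I ∈ S} ∑_{ε ∈ 𝒮} V_I^{-1} f_I^ε h_I^ε(x)`. -/
def projInv {d n : ℕ} (V : DCube d → Matrix (Fin n) (Fin n) ℂ) (S : Set (DCube d))
    (f : (Fin d → ℝ) → EuclideanSpace ℂ (Fin n)) (x : Fin d → ℝ) :
    EuclideanSpace ℂ (Fin n) :=
  ∑' I : S, ∑ ε ∈ Sfin d,
    haarFn (I : DCube d) ε x • mApp ((V (I : DCube d))⁻¹) (haarCoef f (I : DCube d) ε)

/-- A function has finite Haar expansion if it is a finite sum of Haar functions. -/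
def FiniteHaar {d n : ℕ} (f : (Fin d → ℝ) → EuclideanSpace ℂ (Fin n)) : Prop :=
  ∃ F : Finset (DCube d × (Fin d → Bool)),
    ∀ x, f x = ∑ q ∈ F, haarFn q.1 q.2 x • haarCoef f q.1 q.2

/-! ## The weighted stopping time -/

/-- The stopping condition `‖V_J V_I^{-1}‖^p > λ₁` or `‖V_J^{-1} V_I‖^{p'} > λ₂`. -/
def stopBad {d n : ℕ} (p l₁ l₂ : ℝ) (V : DCube d → Matrix (Fin n) (Fin n) ℂ)
    (J I : DCube d) : Prop :=
  l₁ < matNorm (V J * (V I)⁻¹) ^ p ∨ l₂ < matNorm ((V J)⁻¹ * V I) ^ (p / (p - 1))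

/-- The stopping time `𝒥(I)` = maximal dyadic subcubes `J ⊆ I` satisfying `stopBad`. -/
def stopST {d n : ℕ} (p l₁ l₂ : ℝ) (V : DCube d → Matrix (Fin n) (Fin n) ℂ)
    (I : DCube d) : Set (DCube d) :=
  {J | J.set ⊆ I.set ∧ stopBad p l₁ l₂ V J I ∧
    ∀ K : DCube d, K.set ⊆ I.set → stopBad p l₁ l₂ V K I → J.set ⊆ K.set → K = J}


open scoped RealInnerProductSpace in
/-- Concavity of `u` along directions `(h, k)` with `‖k‖ ≤ ‖h‖`, in supporting-functional form. -/
def IsZigzagConcave {E : Type*} [NormedAddCommGroup E] [InnerProductSpace ℝ E]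
    (u : E → E → ℝ) : Prop :=
  ∀ x y, ∃ a b : E, ∀ h k : E, ‖k‖ ≤ ‖h‖ →
    u (x + h) (y + k) ≤ u x y + ⟪a, h⟫ + ⟪b, k⟫

/-- Burkholder's special function for small exponents, as a function of the two norms. -/
def burkholderLow (l r s : ℝ) : ℝ := if r + s ≤ l then s ^ 2 - r ^ 2 else l ^ 2 - 2 * l * r

/-- The special function for large exponents, as a function of the two norms. -/
def burkholderHigh (l r s : ℝ) : ℝ := if r + s ≤ l then 0 else (s - l) ^ 2 - r ^ 2

section Bellman

variable {E : Type*} [NormedAddCommGroup E] [InnerProductSpace ℝ E]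

open scoped RealInnerProductSpace

lemma exists_support_norm (x : E) : ∃ a : E, ∀ h : E, ‖x‖ + ⟪a, h⟫ ≤ ‖x + h‖ := by
  by_cases hx : x = 0
  · exact ⟨0, fun h => by simp [hx]⟩
  · have hx' : 0 < ‖x‖ := norm_pos_iff.2 hx
    refine ⟨‖x‖⁻¹ • x, fun h => ?_⟩
    have h1 := real_inner_le_norm x (x + h)
    rw [inner_add_right, real_inner_self_eq_norm_sq] at h1
    rw [real_inner_smul_left]
    have h2 : ‖x‖ * (‖x‖ + ‖x‖⁻¹ * ⟪x, h⟫) ≤ ‖x‖ * ‖x + h‖ := by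
      rw [mul_add, mul_inv_cancel_left₀ hx'.ne']; nlinarith
    exact le_of_mul_le_mul_left h2 hx'

lemma isZigzagConcave_sq : IsZigzagConcave fun x y : E => ‖y‖ ^ 2 - ‖x‖ ^ 2 := by
  intro x y
  refine ⟨(-2 : ℝ) • x, (2 : ℝ) • y, fun h k hk => ?_⟩
  dsimp only
  rw [norm_add_sq_real, norm_add_sq_real, real_inner_smul_left, real_inner_smul_left]
  have := pow_le_pow_left₀ (norm_nonneg k) hk 2
  linarith

lemma isZigzagConcave_burkholderLow {l : ℝ} (hl : 0 < l) :
    IsZigzagConcave fun x y : E => burkholderLow l ‖x‖ ‖y‖ := by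
  intro x y
  by_cases hxy : ‖x‖ + ‖y‖ ≤ l
  · refine ⟨(-2 : ℝ) • x, (2 : ℝ) • y, fun h k hk => ?_⟩
    simp only [burkholderLow, if_pos hxy, real_inner_smul_left]
    have hx := norm_add_sq_real x h
    have hy := norm_add_sq_real y k
    have hkh := pow_le_pow_left₀ (norm_nonneg k) hk 2
    have hin : ‖y + k‖ ^ 2 - ‖x + h‖ ^ 2 ≤
        ‖y‖ ^ 2 - ‖x‖ ^ 2 + -2 * ⟪x, h⟫ + 2 * ⟪y, k⟫ := by linarith
    split_ifs with h1
    · exact hin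
    · by_cases h2 : ‖x + h‖ ≤ l
      · refine le_trans ?_ hin
        have : (l - ‖x + h‖) ^ 2 ≤ ‖y + k‖ ^ 2 :=
          pow_le_pow_left₀ (by linarith) (by linarith) 2
        nlinarith
      · have hy1 : -(‖y‖ * ‖h‖) ≤ ⟪y, k⟫ := by
          have := neg_le_of_abs_le (abs_real_inner_le_norm y k)
          nlinarith [mul_le_mul_of_nonneg_left hk (norm_nonneg y)]
        have h3 : ‖x + h‖ - l ≤ ‖h‖ - ‖y‖ := by linarith [norm_add_le x h]
        have h4 := pow_le_pow_left₀ (by linarith) h3 2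
        nlinarith
  · obtain ⟨a, ha⟩ := exists_support_norm x
    refine ⟨(-2 * l) • a, 0, fun h k _ => ?_⟩
    simp only [burkholderLow, if_neg hxy, real_inner_smul_left, inner_zero_left]
    have h0 := mul_le_mul_of_nonneg_left (ha h) hl.le
    split_ifs with h1
    · have : ‖y + k‖ ^ 2 ≤ (l - ‖x + h‖) ^ 2 :=
        pow_le_pow_left₀ (norm_nonneg _) (by linarith) 2
      nlinarith
    · nlinarith

lemma isZigzagConcave_burkholderHigh {l : ℝ} (hl : 0 < l) :
    IsZigzagConcave fun x y : E => burkholderHigh l ‖x‖ ‖y‖ := by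
  intro x y
  by_cases hxy : ‖x‖ + ‖y‖ ≤ l
  · refine ⟨0, 0, fun h k hk => ?_⟩
    simp only [burkholderHigh, if_pos hxy, inner_zero_left]
    split_ifs with h1
    · simp
    · have h2 : ‖h‖ ≤ ‖x + h‖ + ‖x‖ := by
        simpa [add_sub_cancel_left] using norm_sub_le (x + h) x
      have h3 := norm_add_le y k
      have h4 : |‖y + k‖ - l| ≤ ‖x + h‖ := abs_le.2 ⟨by linarith, by linarith⟩
      have := sq_le_sq' (neg_le_of_abs_le h4) (le_of_abs_le h4)
      linarith
  · obtain ⟨b, hb⟩ := exists_support_norm y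
    refine ⟨(-2 : ℝ) • x, (2 : ℝ) • y + (-2 * l) • b, fun h k hk => ?_⟩
    simp only [burkholderHigh, if_neg hxy, real_inner_smul_left, inner_add_left]
    have hx := norm_add_sq_real x h
    have hy := norm_add_sq_real y k
    have hkh := pow_le_pow_left₀ (norm_nonneg k) hk 2
    have h0 := mul_le_mul_of_nonneg_left (hb k) hl.le
    have hin : (‖y + k‖ - l) ^ 2 - ‖x + h‖ ^ 2 ≤
        (‖y‖ - l) ^ 2 - ‖x‖ ^ 2 + -2 * ⟪x, h⟫ + (2 * ⟪y, k⟫ + -2 * l * ⟪b, k⟫) := by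
      nlinarith
    split_ifs with h1
    · refine le_trans ?_ hin
      have := pow_le_pow_left₀ (norm_nonneg (x + h)) (show ‖x + h‖ ≤ l - ‖y + k‖ by linarith) 2
      nlinarith
    · exact hin

end Bellman

section Calculus

open Set

lemma burkholderLow_eqOn {p r s : ℝ} :
    EqOn (fun l => l ^ (p - 3) * burkholderLow l r s)
      (fun l => (s ^ 2 - r ^ 2) * l ^ (p - 3)) (Ici (r + s)) := fun l hl => by
  simp only [burkholderLow, if_pos (mem_Ici.1 hl)]; ring

lemma rpow_sub_three_mul {p l : ℝ} (hl : 0 < l) :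
    l ^ (p - 3) * l ^ 2 = l ^ (p - 1) ∧ l ^ (p - 3) * l = l ^ (p - 2) := by
  constructor
  · rw [← Real.rpow_natCast, ← Real.rpow_add hl]; congr 1; push_cast; ring
  · rw [← Real.rpow_add_one hl.ne']; congr 1; ring

lemma integral_burkholderLow {p r s : ℝ} (hp : 1 < p) (hp2 : p < 2) (hr : 0 ≤ r) (hs : 0 ≤ s) :
    IntegrableOn (fun l => l ^ (p - 3) * burkholderLow l r s) (Ioi 0) ∧
    ∫ l in Ioi 0, l ^ (p - 3) * burkholderLow l r s =
      (r + s) ^ (p - 1) *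
        ((1 / p + 1 / (2 - p)) * s - (2 / (p - 1) + 1 / (2 - p) - 1 / p) * r) := by
  rcases (add_nonneg hr hs).eq_or_lt with ht | ht
  · obtain rfl : r = 0 := by linarith
    obtain rfl : s = 0 := by linarith
    have : EqOn (fun l => l ^ (p - 3) * burkholderLow l 0 0) (fun _ => (0 : ℝ)) (Ioi 0) :=
      fun l hl => by simp [burkholderLow, (mem_Ioi.1 hl).le]
    exact ⟨integrableOn_zero.congr_fun this.symm measurableSet_Ioi,
      by rw [setIntegral_congr_fun measurableSet_Ioi this]; simp⟩
  set t := r + s with htdef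
  have e1 : EqOn (fun l => l ^ (p - 3) * burkholderLow l r s)
      (fun l => (s ^ 2 - r ^ 2) * l ^ (p - 3)) (Ioi t) :=
    burkholderLow_eqOn.mono Ioi_subset_Ici_self
  have e2 : EqOn (fun l => l ^ (p - 3) * burkholderLow l r s)
      (fun l => l ^ (p - 1) - 2 * r * l ^ (p - 2)) (Ioo 0 t) := fun l hl => by
    obtain ⟨h1, h2⟩ := rpow_sub_three_mul (p := p) hl.1
    simp only [burkholderLow, if_neg (not_le.2 (htdef ▸ hl.2))]
    rw [mul_sub, h1, ← h2]; ring
  have i1 : IntegrableOn (fun l => (s ^ 2 - r ^ 2) * l ^ (p - 3)) (Ioi t) :=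
    (integrableOn_Ioi_rpow_of_lt (by linarith) ht).const_mul _
  have i2a : IntervalIntegrable (fun l : ℝ => l ^ (p - 1)) volume 0 t :=
    intervalIntegral.intervalIntegrable_rpow' (by linarith)
  have i2b : IntervalIntegrable (fun l : ℝ => 2 * r * l ^ (p - 2)) volume 0 t :=
    (intervalIntegral.intervalIntegrable_rpow' (by linarith)).const_mul _
  have i2 : IntegrableOn (fun l => l ^ (p - 1) - 2 * r * l ^ (p - 2)) (Ioc 0 t) :=
    (intervalIntegrable_iff_integrableOn_Ioc_of_le ht.le).1 (i2a.sub i2b)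
  have j1 := i1.congr_fun e1.symm measurableSet_Ioi
  have j2 : IntegrableOn (fun l => l ^ (p - 3) * burkholderLow l r s) (Ioc 0 t) :=
    (integrableOn_Ioc_iff_integrableOn_Ioo enorm_ne_top).2
      ((i2.mono_set Ioo_subset_Ioc_self).congr_fun e2.symm measurableSet_Ioo)
  have hU : Ioc 0 t ∪ Ioi t = Ioi 0 := Ioc_union_Ioi_eq_Ioi ht.le
  refine ⟨hU ▸ j2.union j1, ?_⟩
  rw [← hU, setIntegral_union (by rw [disjoint_left]; exact fun a ha hb => absurd ha.2 (not_le.2 hb))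
    measurableSet_Ioi j2 j1, setIntegral_congr_fun measurableSet_Ioi e1,
    integral_Ioc_eq_integral_Ioo, setIntegral_congr_fun measurableSet_Ioo e2,
    ← integral_Ioc_eq_integral_Ioo, ← intervalIntegral.integral_of_le ht.le,
    intervalIntegral.integral_sub i2a i2b, intervalIntegral.integral_const_mul,
    integral_const_mul, integral_rpow (Or.inl (by linarith)), integral_rpow (Or.inl (by linarith)),
    integral_Ioi_rpow_of_lt (by linarith) ht,
    Real.zero_rpow (by linarith), Real.zero_rpow (by linarith)]
  have h1 : t ^ (p - 1 + 1) = t ^ (p - 1) * t := Real.rpow_add_one ht.ne' _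
  have h2 : t ^ (p - 1) = t ^ (p - 3 + 1) * t := by
    rw [← Real.rpow_add_one ht.ne']; congr 1; ring
  rw [h1, show p - 2 + 1 = p - 1 by ring, h2, show s ^ 2 - r ^ 2 = t * (s - r) by rw [htdef]; ring]
  have : p - 1 ≠ 0 := by linarith
  have : 2 - p ≠ 0 := by linarith
  have : p - 3 + 1 ≠ 0 := by linarith
  have : p ≠ 0 := by linarith
  rw [show p - 3 + 1 = -(2 - p) by ring]
  generalize t ^ (-(2 - p)) = z
  rw [htdef, show p - 1 + 1 = p by ring]
  field_simp
  ring

lemma integral_burkholderHigh {p r s : ℝ} (hp2 : 2 < p) (hr : 0 ≤ r) (hs : 0 ≤ s) :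
    IntegrableOn (fun l => l ^ (p - 3) * burkholderHigh l r s) (Ioi 0) ∧
    ∫ l in Ioi 0, l ^ (p - 3) * burkholderHigh l r s =
      (r + s) ^ (p - 1) *
        ((2 / (p * (p - 1) * (p - 2))) * s - (1 / (p - 2) - 1 / p) * r) := by
  set t := r + s with htdef
  have ht : 0 ≤ t := add_nonneg hr hs
  have e1 : EqOn (fun l => l ^ (p - 3) * burkholderHigh l r s) (fun _ => (0 : ℝ)) (Ioi t) :=
    fun l hl => by simp [burkholderHigh, (htdef ▸ (mem_Ioi.1 hl).le : r + s ≤ l)]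
  have e2 : EqOn (fun l => l ^ (p - 3) * burkholderHigh l r s)
      (fun l => (s ^ 2 - r ^ 2) * l ^ (p - 3) - 2 * s * l ^ (p - 2) + l ^ (p - 1))
      (Ioo 0 t) := fun l hl => by
    obtain ⟨h1, h2⟩ := rpow_sub_three_mul (p := p) hl.1
    simp only [burkholderHigh, if_neg (not_le.2 (htdef ▸ hl.2))]
    rw [← h1, ← h2]; ring
  have i1 : IntegrableOn (fun _ => (0 : ℝ)) (Ioi t) := integrableOn_zero
  have i2a : IntervalIntegrable (fun l : ℝ => l ^ (p - 1)) volume 0 t :=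
    intervalIntegral.intervalIntegrable_rpow' (by linarith)
  have i2b : IntervalIntegrable (fun l : ℝ => 2 * s * l ^ (p - 2)) volume 0 t :=
    (intervalIntegral.intervalIntegrable_rpow' (by linarith)).const_mul _
  have i2c : IntervalIntegrable (fun l : ℝ => (s ^ 2 - r ^ 2) * l ^ (p - 3)) volume 0 t :=
    (intervalIntegral.intervalIntegrable_rpow' (by linarith)).const_mul _
  have i2 : IntegrableOn
      (fun l => (s ^ 2 - r ^ 2) * l ^ (p - 3) - 2 * s * l ^ (p - 2) + l ^ (p - 1)) (Ioc 0 t) :=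
    (intervalIntegrable_iff_integrableOn_Ioc_of_le ht).1 ((i2c.sub i2b).add i2a)
  have j1 := i1.congr_fun e1.symm measurableSet_Ioi
  have j2 : IntegrableOn (fun l => l ^ (p - 3) * burkholderHigh l r s) (Ioc 0 t) :=
    (integrableOn_Ioc_iff_integrableOn_Ioo enorm_ne_top).2
      ((i2.mono_set Ioo_subset_Ioc_self).congr_fun e2.symm measurableSet_Ioo)
  have hU : Ioc 0 t ∪ Ioi t = Ioi 0 := Ioc_union_Ioi_eq_Ioi ht
  refine ⟨hU ▸ j2.union j1, ?_⟩
  rw [← hU, setIntegral_union (by rw [disjoint_left]; exact fun a ha hb => absurd ha.2 (not_le.2 hb))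
    measurableSet_Ioi j2 j1, setIntegral_congr_fun measurableSet_Ioi e1,
    integral_Ioc_eq_integral_Ioo, setIntegral_congr_fun measurableSet_Ioo e2,
    ← integral_Ioc_eq_integral_Ioo, ← intervalIntegral.integral_of_le ht,
    intervalIntegral.integral_add (i2c.sub i2b) i2a,
    intervalIntegral.integral_sub i2c i2b, intervalIntegral.integral_const_mul,
    intervalIntegral.integral_const_mul,
    integral_rpow (Or.inl (by linarith)), integral_rpow (Or.inl (by linarith)),
    integral_rpow (Or.inl (by linarith)),
    Real.zero_rpow (by linarith), Real.zero_rpow (by linarith), Real.zero_rpow (by linarith)]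
  have h1 : t ^ (p - 1 + 1) = t ^ (p - 1) * t := by
    rw [← Real.rpow_add_one' ht (by linarith)]
  have h2 : t ^ (p - 1) = t ^ (p - 3 + 1) * t := by
    rw [← Real.rpow_add_one' ht (by linarith)]; congr 1; ring
  rw [h1, show p - 2 + 1 = p - 1 by ring, h2, show s ^ 2 - r ^ 2 = t * (s - r) by rw [htdef]; ring]
  have : p - 1 ≠ 0 := by linarith
  have : p - 2 ≠ 0 := by linarith
  have : p ≠ 0 := by linarith
  rw [show p - 3 + 1 = p - 2 by ring]
  generalize t ^ (p - 2) = z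
  rw [htdef, show p - 1 + 1 = p by ring]
  simp only [integral_const, smul_zero]
  field_simp
  ring

/-- Pointwise comparison of the homogeneous Burkholder functional with `s ^ p` and `r ^ p`. -/
lemma exists_rpow_le_burkholder {p a b : ℝ} (hp : 1 < p) (ha : 0 < a) (hb : 0 < b) :
    ∃ C : ℝ, 0 < C ∧ ∀ r s : ℝ, 0 ≤ r → 0 ≤ s →
      s ^ p ≤ 2 / a * ((r + s) ^ (p - 1) * (a * s - b * r)) + C * r ^ p := by
  set q := 2 * b / a with hq
  have hq0 : 0 < q := by positivity
  have hmul : ∀ z : ℝ, 0 ≤ z → z ^ p = z ^ (p - 1) * z := fun z hz => by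
    rw [← Real.rpow_add_one' hz (by linarith)]; congr 1; ring
  refine ⟨q ^ p + 2 / a * (b * (1 + q) ^ (p - 1)), by positivity, fun r s hr hs => ?_⟩
  rcases le_total (q * r) s with h | h
  · have h1 : a / 2 * s ≤ a * s - b * r := by
      have : a * (q * r) = 2 * b * r := by rw [hq]; field_simp
      nlinarith
    have h2 : s ^ (p - 1) ≤ (r + s) ^ (p - 1) :=
      Real.rpow_le_rpow hs (by linarith) (by linarith)
    have h3 : s ^ (p - 1) * (a / 2 * s) ≤ (r + s) ^ (p - 1) * (a * s - b * r) :=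
      mul_le_mul h2 h1 (by positivity) (by positivity)
    have h4 := mul_le_mul_of_nonneg_left h3 (show 0 ≤ 2 / a by positivity)
    have h5 : 2 / a * (s ^ (p - 1) * (a / 2 * s)) = s ^ p := by rw [hmul s hs]; field_simp
    have h6 : 0 ≤ (q ^ p + 2 / a * (b * (1 + q) ^ (p - 1))) * r ^ p := by positivity
    linarith
  · have h1 : s ^ p ≤ q ^ p * r ^ p := by
      rw [← Real.mul_rpow hq0.le hr]; exact Real.rpow_le_rpow hs h (by linarith)
    have h2 : (r + s) ^ (p - 1) ≤ (1 + q) ^ (p - 1) * r ^ (p - 1) := by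
      rw [← Real.mul_rpow (by positivity) hr]
      exact Real.rpow_le_rpow (by positivity) (by nlinarith) (by linarith)
    have h3 : -(b * (1 + q) ^ (p - 1) * r ^ p) ≤ (r + s) ^ (p - 1) * (a * s - b * r) := by
      have h4 := mul_le_mul_of_nonneg_right h2 (show 0 ≤ b * r by positivity)
      have h5 : 0 ≤ (r + s) ^ (p - 1) * (a * s) := by positivity
      rw [hmul r hr]
      nlinarith
    have h4 := mul_le_mul_of_nonneg_left h3 (show 0 ≤ 2 / a by positivity)
    nlinarith

end Calculus

namespace DCube

variable {d : ℕ}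

/-- The dyadic subcube of half the side length selected by the signature `σ`. -/
def child (J : DCube d) (σ : Fin d → Bool) : DCube d :=
  ⟨J.k - 1, fun i => 2 * J.m i + if σ i then 1 else 0⟩

/-- The dyadic cube of side length `2 ^ k` containing `x`. -/
def cubeAt (k : ℤ) (x : Fin d → ℝ) : DCube d := ⟨k, fun i => ⌊x i / 2 ^ k⌋⟩

lemma two_zpow_pos (k : ℤ) : (0 : ℝ) < 2 ^ k := by positivity

lemma two_zpow_eq (k : ℤ) : (2 : ℝ) ^ k = 2 * 2 ^ (k - 1) := by
  rw [zpow_sub_one₀ two_ne_zero]; ring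

lemma mem_set_iff {I : DCube d} {x : Fin d → ℝ} : x ∈ I.set ↔ cubeAt I.k x = I := by
  cases I with
  | mk k m =>
    simp only [set, cubeAt, Set.mem_ofPred_eq, DCube.mk.injEq, true_and, funext_iff,
      Int.floor_eq_iff, le_div_iff₀ (two_zpow_pos k), div_lt_iff₀ (two_zpow_pos k)]

lemma mem_cubeAt (k : ℤ) (x : Fin d → ℝ) : x ∈ (cubeAt k x).set := mem_set_iff.2 rfl

lemma corner_mem (J : DCube d) : J.corner ∈ J.set := fun i => by
  have := two_zpow_pos J.k
  simp only [corner]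
  constructor <;> nlinarith

lemma vol_pos (I : DCube d) : 0 < I.vol := by unfold vol; positivity

lemma mem_child_iff {J : DCube d} {σ : Fin d → Bool} {x : Fin d → ℝ} :
    x ∈ (J.child σ).set ↔ ∀ i, (2 * J.m i + if σ i then 1 else 0 : ℝ) * 2 ^ (J.k - 1) ≤ x i ∧
      x i < ((2 * J.m i + if σ i then 1 else 0 : ℝ) + 1) * 2 ^ (J.k - 1) := by
  refine forall_congr' fun i => ?_
  cases h : σ i <;> simp [child, h]

lemma child_subset (J : DCube d) (σ : Fin d → Bool) : (J.child σ).set ⊆ J.set := by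
  intro x hx i
  have h := mem_child_iff.1 hx i
  have hw := two_zpow_pos (J.k - 1)
  rw [two_zpow_eq J.k]
  split_ifs at h <;> constructor <;> nlinarith

lemma iUnion_child (J : DCube d) : ⋃ σ, (J.child σ).set = J.set := by
  refine Set.Subset.antisymm (Set.iUnion_subset (child_subset J)) fun x hx => ?_
  refine Set.mem_iUnion.2 ⟨fun i => decide ((2 * J.m i + 1 : ℝ) * 2 ^ (J.k - 1) ≤ x i), ?_⟩
  refine mem_child_iff.2 fun i => ?_
  have h := hx i
  rw [two_zpow_eq J.k] at h
  simp only [decide_eq_true_eq]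
  split_ifs with h1 <;> constructor <;> nlinarith

lemma child_injective (J : DCube d) : Function.Injective J.child := by
  intro σ τ h
  simp only [child, DCube.mk.injEq, true_and, funext_iff] at h
  funext i
  have := h i
  cases hσ : σ i <;> cases hτ : τ i <;> simp_all

open Function in
lemma pairwise_disjoint_child (J : DCube d) : Pairwise (Disjoint on fun σ => (J.child σ).set) := by
  intro σ τ hne
  refine Set.disjoint_left.2 fun x hx hx' => hne (J.child_injective ?_)
  rw [← mem_set_iff.1 hx, ← mem_set_iff.1 hx']; rfl

lemma set_eq_pi (I : DCube d) : I.set = Set.univ.pi fun i =>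
    Set.Ico ((I.m i : ℝ) * 2 ^ I.k) (((I.m i : ℝ) + 1) * 2 ^ I.k) := by
  ext x; simp [set]

lemma measurableSet_set (I : DCube d) : MeasurableSet I.set := by
  rw [set_eq_pi]; exact MeasurableSet.univ_pi fun _ => measurableSet_Ico

lemma volume_set (I : DCube d) : volume I.set = ENNReal.ofReal I.vol := by
  rw [set_eq_pi, Real.volume_pi_Ico, vol]
  have : ∀ i, ((I.m i : ℝ) + 1) * 2 ^ I.k - (I.m i : ℝ) * 2 ^ I.k = 2 ^ I.k := fun i => by ring
  simp_rw [this]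
  rw [Finset.prod_const, ENNReal.ofReal_pow (two_zpow_pos _).le]
  simp

lemma volume_real_set (I : DCube d) : volume.real I.set = I.vol := by
  rw [Measure.real, volume_set, ENNReal.toReal_ofReal I.vol_pos.le]

lemma vol_child (J : DCube d) (σ : Fin d → Bool) : J.vol = 2 ^ d * (J.child σ).vol := by
  rw [vol, two_zpow_eq, mul_pow]; rfl

lemma level_le_of_subset (hd : 0 < d) {J K : DCube d} (h : J.set ⊆ K.set) : J.k ≤ K.k := by
  have h1 := measure_mono (μ := volume) h
  rw [volume_set, volume_set, ENNReal.ofReal_le_ofReal_iff K.vol_pos.le, vol, vol,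
    pow_le_pow_iff_left₀ (two_zpow_pos _).le (two_zpow_pos _).le hd.ne'] at h1
  exact (zpow_le_zpow_iff_right₀ _root_.one_lt_two).1 h1

lemma eq_of_subset_of_level {J K : DCube d} (h : J.set ⊆ K.set) (hk : J.k = K.k) : J = K := by
  rw [← mem_set_iff.1 J.corner_mem, hk]
  exact mem_set_iff.1 (h J.corner_mem)

lemma le_coord_of_le_coord {K : DCube d} {x y : Fin d → ℝ} (hx : x ∈ K.set) (hy : y ∈ K.set)
    {k : ℤ} (hk : K.k ≤ k) (z : ℤ) (i : Fin d) (h : (z : ℝ) * 2 ^ k ≤ x i) :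
    (z : ℝ) * 2 ^ k ≤ y i := by
  obtain ⟨e, rfl⟩ := Int.le.dest hk
  have hw := two_zpow_pos K.k
  have hz : (z : ℝ) * 2 ^ (K.k + e) = ((z * 2 ^ e : ℤ) : ℝ) * 2 ^ K.k := by
    rw [zpow_add₀ two_ne_zero]; push_cast; rw [zpow_natCast]; ring
  rw [hz] at h ⊢
  have h1 : ((z * 2 ^ e : ℤ) : ℝ) < ((K.m i + 1 : ℤ) : ℝ) := by
    push_cast
    have := lt_of_le_of_lt h (hx i).2
    push_cast at this
    exact lt_of_mul_lt_mul_right this hw.le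
  have h2 : z * 2 ^ e ≤ K.m i := Int.lt_add_one_iff.1 (Int.cast_lt.1 h1)
  have h3 : ((z * 2 ^ e : ℤ) : ℝ) ≤ (K.m i : ℝ) := Int.cast_le.2 h2
  exact (mul_le_mul_of_nonneg_right h3 hw.le).trans (hy i).1

lemma le_coord_iff {K : DCube d} {x y : Fin d → ℝ} (hx : x ∈ K.set) (hy : y ∈ K.set)
    {k : ℤ} (hk : K.k ≤ k) (z : ℤ) (i : Fin d) :
    (z : ℝ) * 2 ^ k ≤ x i ↔ (z : ℝ) * 2 ^ k ≤ y i :=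
  ⟨le_coord_of_le_coord hx hy hk z i, le_coord_of_le_coord hy hx hk z i⟩

lemma cubeAt_congr {K : DCube d} {x y : Fin d → ℝ} (hx : x ∈ K.set) (hy : y ∈ K.set)
    {k : ℤ} (hk : K.k ≤ k) : cubeAt k x = cubeAt k y := by
  simp only [cubeAt, DCube.mk.injEq, true_and]
  funext i
  refine eq_of_forall_le_iff fun z => ?_
  rw [Int.le_floor, Int.le_floor, le_div_iff₀ (two_zpow_pos k), le_div_iff₀ (two_zpow_pos k)]
  exact le_coord_iff hx hy hk z i

lemma cubeAt_sub_one_eq_child (k : ℤ) (x : Fin d → ℝ) :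
    ∃ σ, cubeAt (k - 1) x = (cubeAt k x).child σ := by
  have h : x ∈ ⋃ σ, ((cubeAt k x).child σ).set := by rw [iUnion_child]; exact mem_cubeAt k x
  obtain ⟨σ, hσ⟩ := Set.mem_iUnion.1 h
  exact ⟨σ, mem_set_iff.1 hσ⟩

end DCube

section Haar

variable {d n : ℕ}

lemma haar1D_congr (ε : Bool) (k m : ℤ) {s t : ℝ}
    (h : ∀ z : ℤ, (z : ℝ) * 2 ^ (k - 1) ≤ s ↔ (z : ℝ) * 2 ^ (k - 1) ≤ t) :
    haar1D ε k m s = haar1D ε k m t := by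
  have h0 : (m : ℝ) * 2 ^ k = ((2 * m : ℤ) : ℝ) * 2 ^ (k - 1) := by
    rw [DCube.two_zpow_eq k]; push_cast; ring
  have h1 : ((2 * m : ℤ) : ℝ) * 2 ^ (k - 1) + 2 ^ (k - 1) = ((2 * m + 1 : ℤ) : ℝ) * 2 ^ (k - 1) := by
    push_cast; ring
  have h2 : ((m : ℝ) + 1) * 2 ^ k = ((2 * m + 2 : ℤ) : ℝ) * 2 ^ (k - 1) := by
    rw [DCube.two_zpow_eq k]; push_cast; ring
  simp only [haar1D, h0, h1, h2, Set.indicator_apply, Set.mem_ofPred_eq, ← not_le, h]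

lemma haarFn_congr (J : DCube d) (ε : Fin d → Bool) {K : DCube d} (hK : K.k ≤ J.k - 1)
    {x y : Fin d → ℝ} (hx : x ∈ K.set) (hy : y ∈ K.set) : haarFn J ε x = haarFn J ε y :=
  Finset.prod_congr rfl fun i _ => haar1D_congr _ _ _ fun z => DCube.le_coord_iff hx hy hK z i

lemma measurable_haar1D (ε : Bool) (k m : ℤ) : Measurable (haar1D ε k m) := by
  unfold haar1D
  have h : ∀ a b : ℝ, MeasurableSet {s : ℝ | a ≤ s ∧ s < b} := fun a b => measurableSet_Ico
  cases ε
  · simp only [Bool.false_eq_true, if_false]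
    exact (measurable_const.indicator (h _ _)).sub (measurable_const.indicator (h _ _))
  · simp only [if_true]
    exact measurable_const.indicator (h _ _)

lemma integrable_haar1D (ε : Bool) (k m : ℤ) : Integrable (haar1D ε k m) := by
  have h : ∀ a b c : ℝ, Integrable (Set.indicator {s : ℝ | a ≤ s ∧ s < b} fun _ => c) :=
    fun a b c => (integrable_indicator_iff measurableSet_Ico).2
      (integrableOn_const (by simp))
  unfold haar1D
  cases ε
  · simp only [Bool.false_eq_true, if_false]
    exact (h _ _ _).sub (h _ _ _)
  · simp only [if_true]
    exact h _ _ _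

lemma abs_haar1D_le (ε : Bool) (k m : ℤ) (t : ℝ) :
    |haar1D ε k m t| ≤ ((2 : ℝ) ^ k) ^ (-(1 / 2 : ℝ)) := by
  have hc : 0 < ((2 : ℝ) ^ k) ^ (-(1 / 2 : ℝ)) := Real.rpow_pos_of_pos (DCube.two_zpow_pos k) _
  unfold haar1D
  generalize ((2 : ℝ) ^ k) ^ (-(1 / 2 : ℝ)) = c at hc ⊢
  cases ε
  · simp only [Bool.false_eq_true, if_false, Set.indicator_apply, Set.mem_ofPred_eq]
    split_ifs
    · simp [hc.le]
    · simp [abs_of_pos hc]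
    · simp [abs_of_pos hc]
    · simp [hc.le]
  · simp only [if_true, Set.indicator_apply, Set.mem_ofPred_eq]
    split_ifs
    · simp [abs_of_pos hc]
    · simp [hc.le]

lemma haar1D_eq_zero (ε : Bool) {k m : ℤ} {t : ℝ}
    (ht : ¬((m : ℝ) * 2 ^ k ≤ t ∧ t < ((m : ℝ) + 1) * 2 ^ k)) : haar1D ε k m t = 0 := by
  have hw := DCube.two_zpow_pos (k - 1)
  unfold haar1D
  generalize ((2 : ℝ) ^ k) ^ (-(1 / 2 : ℝ)) = c
  rw [DCube.two_zpow_eq k] at ht ⊢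
  cases ε
  · simp only [Bool.false_eq_true, if_false, Set.indicator_apply, Set.mem_ofPred_eq]
    rw [if_neg (fun h => ht ⟨h.1, by nlinarith [h.2]⟩),
      if_neg (fun h => ht ⟨by nlinarith [h.1], h.2⟩), sub_zero]
  · simp only [if_true, Set.indicator_apply, Set.mem_ofPred_eq]
    rw [if_neg ht]

lemma haar1D_of_mem {b : Bool} {k m : ℤ} {t : ℝ}
    (ht : (2 * m + if b then 1 else 0 : ℝ) * 2 ^ (k - 1) ≤ t ∧
      t < ((2 * m + if b then 1 else 0 : ℝ) + 1) * 2 ^ (k - 1)) :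
    haar1D true k m t = ((2 : ℝ) ^ k) ^ (-(1 / 2 : ℝ)) ∧
      haar1D false k m t = (if b then -1 else 1) * ((2 : ℝ) ^ k) ^ (-(1 / 2 : ℝ)) := by
  have hw := DCube.two_zpow_pos (k - 1)
  unfold haar1D
  generalize ((2 : ℝ) ^ k) ^ (-(1 / 2 : ℝ)) = c
  rw [DCube.two_zpow_eq k]
  simp only [if_true, Bool.false_eq_true, if_false, Set.indicator_apply, Set.mem_ofPred_eq]
  generalize (2 : ℝ) ^ (k - 1) = w at ht hw
  cases b
  · simp only [Bool.false_eq_true, if_false] at ht ⊢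
    rw [if_pos ⟨by linarith, by linarith⟩, if_pos ⟨by linarith, by linarith⟩,
      if_neg (fun h => by linarith [h.1])]
    exact ⟨rfl, by ring⟩
  · simp only [if_true] at ht ⊢
    rw [if_pos ⟨by linarith, by linarith⟩, if_neg (fun h => by linarith [h.2]),
      if_pos ⟨by linarith, by linarith⟩]
    exact ⟨rfl, by ring⟩

lemma rpow_neg_half_mul_self (k : ℤ) :
    ((2 : ℝ) ^ k) ^ (-(1 / 2 : ℝ)) * ((2 : ℝ) ^ k) ^ (-(1 / 2 : ℝ)) = ((2 : ℝ) ^ k)⁻¹ := by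
  rw [← Real.rpow_add (DCube.two_zpow_pos k), ← Real.rpow_neg_one]; norm_num

lemma haar1D_true_mul (k m : ℤ) (s t : ℝ) :
    haar1D true k m t * haar1D true k m s =
      if ((m : ℝ) * 2 ^ k ≤ t ∧ t < (m + 1) * 2 ^ k) ∧ ((m : ℝ) * 2 ^ k ≤ s ∧ s < (m + 1) * 2 ^ k)
      then ((2 : ℝ) ^ k)⁻¹ else 0 := by
  rw [← rpow_neg_half_mul_self]
  simp only [haar1D, if_true, Set.indicator_apply, Set.mem_ofPred_eq]
  split_ifs <;> simp_all

lemma sum_haar1D_mul (b : Bool) (k m : ℤ) (s t : ℝ)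
    (ht : (2 * m + if b then 1 else 0 : ℝ) * 2 ^ (k - 1) ≤ t ∧
      t < ((2 * m + if b then 1 else 0 : ℝ) + 1) * 2 ^ (k - 1)) :
    ∑ ε : Bool, haar1D ε k m t * haar1D ε k m s =
      if (2 * m + if b then 1 else 0 : ℝ) * 2 ^ (k - 1) ≤ s ∧
        s < ((2 * m + if b then 1 else 0 : ℝ) + 1) * 2 ^ (k - 1)
      then ((2 : ℝ) ^ (k - 1))⁻¹ else 0 := by
  have hinv : ((2 : ℝ) ^ (k - 1))⁻¹ = 2 * ((2 : ℝ) ^ k)⁻¹ := by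
    rw [DCube.two_zpow_eq k]; field_simp
  have hw := DCube.two_zpow_pos (k - 1)
  rw [hinv, ← rpow_neg_half_mul_self k, Fintype.sum_bool, (haar1D_of_mem ht).1,
    (haar1D_of_mem ht).2]
  by_cases hs : ∃ b' : Bool, (2 * m + if b' then 1 else 0 : ℝ) * 2 ^ (k - 1) ≤ s ∧
      s < ((2 * m + if b' then 1 else 0 : ℝ) + 1) * 2 ^ (k - 1)
  · obtain ⟨b', hs⟩ := hs
    rw [(haar1D_of_mem hs).1, (haar1D_of_mem hs).2]
    generalize ((2 : ℝ) ^ k) ^ (-(1 / 2 : ℝ)) = c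
    generalize (2 : ℝ) ^ (k - 1) = w at hs hw
    cases b <;> cases b' <;>
      simp only [Bool.false_eq_true, if_false, if_true] at hs ⊢
    · rw [if_pos hs]; ring
    · rw [if_neg (fun h => by linarith [h.2])]; ring
    · rw [if_neg (fun h => by linarith [h.1])]; ring
    · rw [if_pos hs]; ring
  · have hs' : ¬((m : ℝ) * 2 ^ k ≤ s ∧ s < ((m : ℝ) + 1) * 2 ^ k) := by
      rintro ⟨h1, h2⟩
      rw [DCube.two_zpow_eq k] at h1 h2
      refine hs ⟨decide ((2 * m + 1 : ℝ) * 2 ^ (k - 1) ≤ s), ?_⟩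
      simp only [decide_eq_true_eq]
      split_ifs with h3 <;> constructor <;> nlinarith
    rw [haar1D_eq_zero _ hs', haar1D_eq_zero _ hs', if_neg fun h => hs ⟨b, h⟩]
    simp

lemma prod_ite_zero' (P : Fin d → Prop) [DecidablePred P] [Decidable (∀ i, P i)] (c : ℝ) :
    ∏ i, (if P i then c else 0) = if ∀ i, P i then c ^ d else 0 := by
  split_ifs with h
  · simp [h]
  · push Not at h
    obtain ⟨i, hi⟩ := h
    exact Finset.prod_eq_zero (Finset.mem_univ i) (if_neg hi)

lemma sum_haarFn_mul (J : DCube d) {σ : Fin d → Bool} {x : Fin d → ℝ}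
    (hx : x ∈ (J.child σ).set) (y : Fin d → ℝ) :
    ∑ ε ∈ Sfin d, haarFn J ε x * haarFn J ε y =
      (J.child σ).set.indicator (fun _ => (J.child σ).vol⁻¹) y -
        J.set.indicator (fun _ => J.vol⁻¹) y := by
  classical
  have hall : ∑ ε : Fin d → Bool, haarFn J ε x * haarFn J ε y =
      (J.child σ).set.indicator (fun _ => (J.child σ).vol⁻¹) y := by
    simp only [haarFn, ← Finset.prod_mul_distrib]
    rw [← Fintype.prod_sum fun i (b : Bool) =>
      haar1D b J.k (J.m i) (x i) * haar1D b J.k (J.m i) (y i)]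
    have h1 := DCube.mem_child_iff.1 hx
    rw [Finset.prod_congr rfl fun i _ => sum_haar1D_mul (σ i) J.k (J.m i) (y i) (x i) (h1 i),
      prod_ite_zero', Set.indicator_apply]
    simp only [DCube.mem_child_iff, DCube.vol, inv_pow]
    rfl
  have htrue : haarFn J (fun _ => true) x * haarFn J (fun _ => true) y =
      J.set.indicator (fun _ => J.vol⁻¹) y := by
    simp only [haarFn, ← Finset.prod_mul_distrib, haar1D_true_mul]
    have h1 := J.child_subset σ hx
    rw [prod_ite_zero', Set.indicator_apply]
    have : (∀ i, ((J.m i : ℝ) * 2 ^ J.k ≤ x i ∧ x i < (J.m i + 1) * 2 ^ J.k) ∧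
        ((J.m i : ℝ) * 2 ^ J.k ≤ y i ∧ y i < (J.m i + 1) * 2 ^ J.k)) ↔ y ∈ J.set :=
      ⟨fun h i => (h i).2, fun h i => ⟨h1 i, h i⟩⟩
    simp only [this, DCube.vol, inv_pow]
  rw [Sfin, ← hall, ← htrue, Finset.sum_erase_eq_sub (Finset.mem_univ _)]

lemma haarFn_eq_zero {J : DCube d} (ε : Fin d → Bool) {x : Fin d → ℝ} (hx : x ∉ J.set) :
    haarFn J ε x = 0 := by
  simp only [DCube.set, Set.mem_ofPred_eq, not_forall] at hx
  obtain ⟨i, hi⟩ := hx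
  exact Finset.prod_eq_zero (Finset.mem_univ i) (haar1D_eq_zero _ hi)

lemma measurable_haarFn (J : DCube d) (ε : Fin d → Bool) : Measurable (haarFn J ε) :=
  Finset.measurable_prod _ fun i _ => (measurable_haar1D _ _ _).comp (measurable_pi_apply i)

lemma integrable_haarFn (J : DCube d) (ε : Fin d → Bool) : Integrable (haarFn J ε) :=
  Integrable.fintype_prod fun i => integrable_haar1D (ε i) J.k (J.m i)

lemma integrable_haarFn_smul (J : DCube d) (ε : Fin d → Bool)
    {f : (Fin d → ℝ) → EuclideanSpace ℂ (Fin n)} (hf : Integrable f) :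
    Integrable fun x => haarFn J ε x • f x := by
  refine hf.bdd_smul ((((2 : ℝ) ^ J.k) ^ (-(1 / 2 : ℝ))) ^ d)
    (measurable_haarFn J ε).aestronglyMeasurable (ae_of_all _ fun x => ?_)
  rw [Real.norm_eq_abs, haarFn, Finset.abs_prod]
  refine (Finset.prod_le_prod (fun _ _ => abs_nonneg _) fun i _ => abs_haar1D_le _ _ _ _).trans ?_
  simp

lemma FiniteHaar.integrable {f : (Fin d → ℝ) → EuclideanSpace ℂ (Fin n)} (hf : FiniteHaar f) :
    Integrable f := by
  obtain ⟨F, hF⟩ := hf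
  have : f = fun x => ∑ q ∈ F, haarFn q.1 q.2 x • haarCoef f q.1 q.2 := funext hF
  rw [this]
  exact integrable_finsetSum _ fun q _ => (integrable_haarFn q.1 q.2).smul_const _

lemma FiniteHaar.exists_level {f : (Fin d → ℝ) → EuclideanSpace ℂ (Fin n)} (hf : FiniteHaar f) :
    ∃ k₀ : ℤ, ∀ K : DCube d, K.k ≤ k₀ → ∀ x ∈ K.set, ∀ y ∈ K.set, f x = f y := by
  obtain ⟨F, hF⟩ := hf
  obtain ⟨b, hb⟩ := (F.image fun q => q.1.k).bddBelow
  refine ⟨b - 1, fun K hK x hx y hy => ?_⟩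
  rw [hF x, hF y]
  refine Finset.sum_congr rfl fun q hq => ?_
  have : b ≤ q.1.k := hb (Finset.mem_coe.2 (Finset.mem_image_of_mem _ hq))
  rw [haarFn_congr q.1 q.2 (by linarith) hx hy]

/-- The average of `f` over a dyadic cube. -/
def cubeAvg (f : (Fin d → ℝ) → EuclideanSpace ℂ (Fin n)) (J : DCube d) :
    EuclideanSpace ℂ (Fin n) := J.vol⁻¹ • ∫ x in J.set, f x

lemma sum_haar_eq_cubeAvg_sub {f : (Fin d → ℝ) → EuclideanSpace ℂ (Fin n)} (hf : Integrable f)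
    (J : DCube d) {σ : Fin d → Bool} {x : Fin d → ℝ} (hx : x ∈ (J.child σ).set) :
    ∑ ε ∈ Sfin d, haarFn J ε x • haarCoef f J ε = cubeAvg f (J.child σ) - cubeAvg f J := by
  have hi : ∀ K : DCube d, ∫ y, K.set.indicator (fun _ => K.vol⁻¹) y • f y = cubeAvg f K := by
    intro K
    rw [cubeAvg, ← integral_smul, ← integral_indicator K.measurableSet_set]
    congr 1; funext y
    by_cases hy : y ∈ K.set <;> simp [hy]
  have hint : ∀ K : DCube d, Integrable fun y => K.set.indicator (fun _ => K.vol⁻¹) y • f y := by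
    intro K
    have : (fun y => K.set.indicator (fun _ => K.vol⁻¹) y • f y) =
        K.set.indicator (fun y => K.vol⁻¹ • f y) := by
      funext y
      by_cases hy : y ∈ K.set <;> simp [hy]
    rw [this]
    exact (hf.smul K.vol⁻¹).indicator K.measurableSet_set
  simp only [haarCoef, ← integral_smul]
  rw [← integral_finsetSum _ fun ε _ => (integrable_haarFn_smul J ε hf).fun_smul _, ← hi, ← hi,
    ← integral_sub (hint _) (hint _)]
  congr 1; funext y
  rw [← sub_smul, ← sum_haarFn_mul J hx y, Finset.sum_smul]
  simp only [smul_smul]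

lemma sum_cubeAvg_child_sub {f : (Fin d → ℝ) → EuclideanSpace ℂ (Fin n)} (hf : Integrable f)
    (J : DCube d) : ∑ σ, (cubeAvg f (J.child σ) - cubeAvg f J) = 0 := by
  have h1 : ∀ σ, cubeAvg f (J.child σ) = (2 ^ d * J.vol⁻¹ : ℝ) • ∫ x in (J.child σ).set, f x := by
    intro σ
    rw [cubeAvg, J.vol_child σ, mul_inv, ← mul_assoc, mul_inv_cancel₀ (by positivity), one_mul]
  simp only [h1, Finset.sum_sub_distrib, ← Finset.smul_sum]
  rw [← integral_iUnion_fintype (fun σ => (J.child σ).measurableSet_set) J.pairwise_disjoint_child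
    fun σ => hf.integrableOn, J.iUnion_child, Finset.sum_const, Finset.card_univ, cubeAvg,
    ← Nat.cast_smul_eq_nsmul ℝ, smul_smul]
  simp

lemma cubeAvg_eq {f : (Fin d → ℝ) → EuclideanSpace ℂ (Fin n)} {J : DCube d} {x : Fin d → ℝ}
    (h : ∀ y ∈ J.set, f y = f x) : cubeAvg f J = f x := by
  rw [cubeAvg, setIntegral_congr_fun J.measurableSet_set h, setIntegral_const,
    DCube.volume_real_set, smul_smul, inv_mul_cancel₀ J.vol_pos.ne', one_smul]

end Haar

section Transform

open DCube

variable {d n : ℕ}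

/-- The sum of `φ` over the `N`-th generation of dyadic descendants of a cube. -/
def descSum (φ : DCube d → ℝ) : ℕ → DCube d → ℝ
  | 0, J => φ J
  | N + 1, J => ∑ σ, descSum φ N (J.child σ)

lemma descSum_mono {φ ψ : DCube d → ℝ} (h : ∀ K, φ K ≤ ψ K) (N : ℕ) (J : DCube d) :
    descSum φ N J ≤ descSum ψ N J := by
  induction N generalizing J with
  | zero => exact h J
  | succ N ih => exact Finset.sum_le_sum fun σ _ => ih _

lemma descSum_nonneg {φ : DCube d → ℝ} (h : ∀ K, 0 ≤ φ K) (N : ℕ) (J : DCube d) :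
    0 ≤ descSum φ N J := by
  induction N generalizing J with
  | zero => exact h J
  | succ N ih => exact Finset.sum_nonneg fun σ _ => ih _

lemma descSum_add (φ ψ : DCube d → ℝ) (N : ℕ) (J : DCube d) :
    descSum (fun K => φ K + ψ K) N J = descSum φ N J + descSum ψ N J := by
  induction N generalizing J with
  | zero => rfl
  | succ N ih => simp only [descSum, ih, Finset.sum_add_distrib]

lemma descSum_const_mul (c : ℝ) (φ : DCube d → ℝ) (N : ℕ) (J : DCube d) :
    descSum (fun K => c * φ K) N J = c * descSum φ N J := by
  induction N generalizing J with
  | zero => rfl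
  | succ N ih => simp only [descSum, ih, Finset.mul_sum]

lemma integral_descSum {φ : ℝ → DCube d → ℝ} {s : Set ℝ}
    (h : ∀ K, IntegrableOn (fun l => φ l K) s) (N : ℕ) (J : DCube d) :
    IntegrableOn (fun l => descSum (φ l) N J) s ∧
      ∫ l in s, descSum (φ l) N J = descSum (fun K => ∫ l in s, φ l K) N J := by
  induction N generalizing J with
  | zero => exact ⟨h J, rfl⟩
  | succ N ih =>
    simp only [descSum]
    refine ⟨integrable_finsetSum _ fun σ _ => (ih _).1, ?_⟩
    rw [integral_finsetSum _ fun σ _ => (ih _).1]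
    exact Finset.sum_congr rfl fun σ _ => (ih _).2

lemma setLIntegral_eq_descSum {Φ : (Fin d → ℝ) → ℝ≥0∞} {φ : DCube d → ℝ} (hφ : ∀ K, 0 ≤ φ K)
    (N : ℕ) (J : DCube d)
    (h : ∀ K : DCube d, K.set ⊆ J.set → K.k = J.k - N → ∀ x ∈ K.set, Φ x = ENNReal.ofReal (φ K)) :
    ∫⁻ x in J.set, Φ x = ENNReal.ofReal (((2 : ℝ) ^ (J.k - N)) ^ d * descSum φ N J) := by
  induction N generalizing J with
  | zero =>
    rw [setLIntegral_congr_fun J.measurableSet_set (h J subset_rfl (by simp)), setLIntegral_const,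
      volume_set, ← ENNReal.ofReal_mul (hφ J), mul_comm]
    simp [descSum, DCube.vol]
  | succ N ih =>
    have hk : ∀ σ, (J.child σ).k - (N : ℤ) = J.k - ((N + 1 : ℕ) : ℤ) := fun σ => by
      simp only [child]; push_cast; ring
    rw [← J.iUnion_child, lintegral_iUnion (fun σ => (J.child σ).measurableSet_set)
      J.pairwise_disjoint_child, tsum_fintype]
    simp only [descSum, Finset.mul_sum]
    rw [ENNReal.ofReal_sum_of_nonneg fun σ _ => mul_nonneg (by positivity) (descSum_nonneg hφ _ _)]
    refine Finset.sum_congr rfl fun σ _ => ?_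
    rw [ih (J.child σ) fun K hK hKk => h K (hK.trans (J.child_subset σ)) (hKk.trans (hk σ)), hk]

section Burkholder

variable {E : Type*} [NormedAddCommGroup E] [InnerProductSpace ℝ E]

lemma descSum_zigzagConcave_le {u : E → E → ℝ} (hu : IsZigzagConcave u) {X Y : DCube d → E}
    {k₁ : ℤ} (hX : ∀ J : DCube d, J.k ≤ k₁ → ∑ σ, (X (J.child σ) - X J) = 0)
    (hY : ∀ J : DCube d, J.k ≤ k₁ → ∑ σ, (Y (J.child σ) - Y J) = 0)
    (hXY : ∀ J : DCube d, J.k ≤ k₁ → ∀ σ, ‖Y (J.child σ) - Y J‖ ≤ ‖X (J.child σ) - X J‖)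
    (N : ℕ) (J : DCube d) (hJ : J.k ≤ k₁) :
    descSum (fun K => u (X K) (Y K)) N J ≤ (2 ^ d) ^ N * u (X J) (Y J) := by
  induction N generalizing J with
  | zero => simp [descSum]
  | succ N ih =>
    obtain ⟨a, b, hab⟩ := hu (X J) (Y J)
    have hstep : ∑ σ, u (X (J.child σ)) (Y (J.child σ)) ≤ 2 ^ d * u (X J) (Y J) := by
      calc ∑ σ, u (X (J.child σ)) (Y (J.child σ))
          ≤ ∑ σ, (u (X J) (Y J) + inner ℝ a (X (J.child σ) - X J) +
              inner ℝ b (Y (J.child σ) - Y J)) := Finset.sum_le_sum fun σ _ => by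
            simpa using hab _ _ (hXY J hJ σ)
        _ = 2 ^ d * u (X J) (Y J) := by
            rw [Finset.sum_add_distrib, Finset.sum_add_distrib, ← inner_sum, ← inner_sum,
              hX J hJ, hY J hJ]
            simp
    calc descSum (fun K => u (X K) (Y K)) (N + 1) J
        ≤ ∑ σ, (2 ^ d) ^ N * u (X (J.child σ)) (Y (J.child σ)) :=
          Finset.sum_le_sum fun σ _ => ih _ (by simp only [child]; linarith)
      _ = (2 ^ d) ^ N * ∑ σ, u (X (J.child σ)) (Y (J.child σ)) := by rw [Finset.mul_sum]
      _ ≤ (2 ^ d) ^ N * (2 ^ d * u (X J) (Y J)) := mul_le_mul_of_nonneg_left hstep (by positivity)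
      _ = (2 ^ d) ^ (N + 1) * u (X J) (Y J) := by ring

/-- If a family of zigzag-concave functions integrates to `t ^ (p - 1) (a s - b r)`, then the
latter has nonpositive mean along differentially subordinate dyadic martingales. -/
lemma descSum_integral_nonpos {w : ℝ → ℝ → ℝ → ℝ} {p : ℝ} {U : ℝ → ℝ → ℝ}
    (hw : ∀ l, 0 < l → IsZigzagConcave fun x y : E => w l ‖x‖ ‖y‖)
    (hw0 : ∀ l r, 0 < l → 0 ≤ r → w l r 0 ≤ 0)
    (hU : ∀ r s, 0 ≤ r → 0 ≤ s → IntegrableOn (fun l => l ^ (p - 3) * w l r s) (Set.Ioi 0) ∧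
      ∫ l in Set.Ioi 0, l ^ (p - 3) * w l r s = U r s)
    {X Y : DCube d → E}
    {k₁ : ℤ} (hX : ∀ J : DCube d, J.k ≤ k₁ → ∑ σ, (X (J.child σ) - X J) = 0)
    (hY : ∀ J : DCube d, J.k ≤ k₁ → ∑ σ, (Y (J.child σ) - Y J) = 0)
    (hXY : ∀ J : DCube d, J.k ≤ k₁ → ∀ σ, ‖Y (J.child σ) - Y J‖ ≤ ‖X (J.child σ) - X J‖)
    (N : ℕ) (J : DCube d) (hJ : J.k ≤ k₁) (hYJ : Y J = 0) :
    descSum (fun K => U ‖X K‖ ‖Y K‖) N J ≤ 0 := by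
  have h1 := (integral_descSum (φ := fun l K => l ^ (p - 3) * w l ‖X K‖ ‖Y K‖)
    (fun K => (hU ‖X K‖ ‖Y K‖ (norm_nonneg _) (norm_nonneg _)).1) N J).2
  simp only [(hU _ _ (norm_nonneg _) (norm_nonneg _)).2] at h1
  rw [← h1]
  refine setIntegral_nonpos measurableSet_Ioi fun l hl => ?_
  rw [descSum_const_mul]
  refine mul_nonpos_of_nonneg_of_nonpos (Real.rpow_nonneg (le_of_lt hl) _) ?_
  refine (descSum_zigzagConcave_le (hw l hl) hX hY hXY N J hJ).trans ?_
  rw [hYJ, norm_zero]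
  exact mul_nonpos_of_nonneg_of_nonpos (by positivity) (hw0 l _ hl (norm_nonneg _))

/-- Burkholder's inequality for differentially subordinate dyadic martingales. -/
lemma exists_descSum_rpow_le (d : ℕ) {p : ℝ} (hp : 1 < p) :
    ∃ C : ℝ, 0 < C ∧ ∀ (E : Type) [NormedAddCommGroup E] [InnerProductSpace ℝ E]
      (X Y : DCube d → E) (k₁ : ℤ),
      (∀ J : DCube d, J.k ≤ k₁ → ∑ σ, (X (J.child σ) - X J) = 0) →
      (∀ J : DCube d, J.k ≤ k₁ → ∑ σ, (Y (J.child σ) - Y J) = 0) →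
      (∀ J : DCube d, J.k ≤ k₁ → ∀ σ, ‖Y (J.child σ) - Y J‖ ≤ ‖X (J.child σ) - X J‖) →
      ∀ (N : ℕ) (J : DCube d), J.k ≤ k₁ → Y J = 0 →
        descSum (fun K => ‖Y K‖ ^ p) N J ≤ C * descSum (fun K => ‖X K‖ ^ p) N J := by
  obtain ⟨a, b, ha, hb, h⟩ : ∃ a b : ℝ, 0 < a ∧ 0 < b ∧
      ∀ (E : Type) [NormedAddCommGroup E] [InnerProductSpace ℝ E]
      (X Y : DCube d → E) (k₁ : ℤ),
      (∀ J : DCube d, J.k ≤ k₁ → ∑ σ, (X (J.child σ) - X J) = 0) →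
      (∀ J : DCube d, J.k ≤ k₁ → ∑ σ, (Y (J.child σ) - Y J) = 0) →
      (∀ J : DCube d, J.k ≤ k₁ → ∀ σ, ‖Y (J.child σ) - Y J‖ ≤ ‖X (J.child σ) - X J‖) →
      ∀ (N : ℕ) (J : DCube d), J.k ≤ k₁ → Y J = 0 →
        descSum (fun K => (‖X K‖ + ‖Y K‖) ^ (p - 1) * (a * ‖Y K‖ - b * ‖X K‖)) N J ≤ 0 := by
    rcases lt_trichotomy p 2 with hp2 | rfl | hp2
    · have e1 : 0 < 2 - p := by linarith
      have e2 : 0 < p - 1 := by linarith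
      have e3 : 1 / p < 2 / (p - 1) := by
        rw [div_lt_div_iff₀ (by linarith) e2]; linarith
      have e4 : 0 < 1 / (2 - p) := by positivity
      refine ⟨1 / p + 1 / (2 - p), 2 / (p - 1) + 1 / (2 - p) - 1 / p, by positivity,
        by linarith, fun E _ _ X Y k₁ hX hY hXY N J hJ hYJ => ?_⟩
      refine descSum_integral_nonpos (w := burkholderLow)
        (U := fun r s => (r + s) ^ (p - 1) *
          ((1 / p + 1 / (2 - p)) * s - (2 / (p - 1) + 1 / (2 - p) - 1 / p) * r))
        (fun l hl => isZigzagConcave_burkholderLow hl) (fun l r hl hr => ?_)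
        (fun r s hr hs => integral_burkholderLow hp hp2 hr hs) hX hY hXY N J hJ hYJ
      simp only [burkholderLow]
      split_ifs <;> nlinarith
    · refine ⟨1, 1, one_pos, one_pos, fun E _ _ X Y k₁ hX hY hXY N J hJ hYJ => ?_⟩
      have h1 := descSum_zigzagConcave_le isZigzagConcave_sq hX hY hXY N J hJ
      have h2 : ∀ r s : ℝ, (r + s) ^ ((2 : ℝ) - 1) * (1 * s - 1 * r) = s ^ 2 - r ^ 2 := by
        intro r s
        rw [show (2 : ℝ) - 1 = 1 by norm_num, Real.rpow_one]; ring
      simp only [h2]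
      refine h1.trans (mul_nonpos_of_nonneg_of_nonpos (by positivity) ?_)
      rw [hYJ, norm_zero]
      nlinarith [sq_nonneg ‖X J‖]
    · have e1 : 0 < p - 2 := by linarith
      have e2 : 0 < p - 1 := by linarith
      have e0 : 0 < p := by linarith
      have e3 : 1 / p < 1 / (p - 2) := one_div_lt_one_div_of_lt e1 (by linarith)
      refine ⟨2 / (p * (p - 1) * (p - 2)), 1 / (p - 2) - 1 / p, by positivity,
        by linarith, fun E _ _ X Y k₁ hX hY hXY N J hJ hYJ => ?_⟩
      refine descSum_integral_nonpos (w := burkholderHigh)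
        (U := fun r s => (r + s) ^ (p - 1) *
          (2 / (p * (p - 1) * (p - 2)) * s - (1 / (p - 2) - 1 / p) * r))
        (fun l hl => isZigzagConcave_burkholderHigh hl) (fun l r hl hr => ?_)
        (fun r s hr hs => integral_burkholderHigh hp2 hr hs) hX hY hXY N J hJ hYJ
      simp only [burkholderHigh]
      split_ifs <;> nlinarith
  obtain ⟨C, hC, hle⟩ := exists_rpow_le_burkholder hp ha hb
  refine ⟨C, hC, fun E _ _ X Y k₁ hX hY hXY N J hJ hYJ => ?_⟩
  have h1 := h E X Y k₁ hX hY hXY N J hJ hYJ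
  refine (descSum_mono (fun K => hle ‖X K‖ ‖Y K‖ (norm_nonneg _) (norm_nonneg _)) N J).trans ?_
  rw [descSum_add, descSum_const_mul, descSum_const_mul]
  have : 2 / a * descSum (fun K => (‖X K‖ + ‖Y K‖) ^ (p - 1) * (a * ‖Y K‖ - b * ‖X K‖)) N J ≤ 0 :=
    mul_nonpos_of_nonneg_of_nonpos (by positivity) h1
  linarith

end Burkholder

/-- The martingale started at zero at level `k₁` with increments `B`, evaluated on cubes. -/
def pathSum {E : Type*} [AddCommMonoid E] (k₁ : ℤ) (B : DCube d → DCube d → E) (K : DCube d) : E :=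
  ∑ j ∈ Finset.range (k₁ - K.k).toNat,
    B (cubeAt (k₁ - j) K.corner) (cubeAt (k₁ - j - 1) K.corner)

lemma pathSum_child {E : Type*} [AddCommGroup E] {k₁ : ℤ} (B : DCube d → DCube d → E)
    {J : DCube d} (hJ : J.k ≤ k₁) (σ : Fin d → Bool) :
    pathSum k₁ B (J.child σ) - pathSum k₁ B J = B J (J.child σ) := by
  obtain ⟨N, hN⟩ := Int.le.dest hJ
  have h1 : (k₁ - (J.child σ).k).toNat = N + 1 := by simp only [child]; omega
  have h2 : (k₁ - J.k).toNat = N := by omega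
  have hmem := (J.child σ).corner_mem
  have hmemJ := J.child_subset σ hmem
  rw [pathSum, pathSum, h1, h2, Finset.sum_range_succ, show k₁ - (N : ℤ) = J.k by omega,
    mem_set_iff.1 hmemJ, show cubeAt (J.k - 1) (J.child σ).corner = J.child σ from
      mem_set_iff.1 hmem, add_comm, add_sub_assoc, sub_eq_zero.2, add_zero]
  refine Finset.sum_congr rfl fun j hj => ?_
  have hj' := Finset.mem_range.1 hj
  rw [cubeAt_congr hmemJ J.corner_mem (by omega), cubeAt_congr hmemJ J.corner_mem (by omega)]

end Transform

section Matrices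

variable {n : ℕ}

lemma norm_mApp_le (A : Matrix (Fin n) (Fin n) ℂ) (v : EuclideanSpace ℂ (Fin n)) :
    ‖mApp A v‖ ≤ matNorm A * ‖v‖ :=
  ContinuousLinearMap.le_opNorm _ _

lemma matNorm_conjTranspose (A : Matrix (Fin n) (Fin n) ℂ) :
    matNorm A.conjTranspose = matNorm A := by
  rw [matNorm, ← Matrix.star_eq_conjTranspose, map_star, ContinuousLinearMap.star_eq_adjoint,
    LinearIsometryEquiv.norm_map, matNorm]

lemma matNorm_mul_inv_comm {A B : Matrix (Fin n) (Fin n) ℂ} (hA : A.IsHermitian)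
    (hB : B.IsHermitian) : matNorm (A * B⁻¹) = matNorm (B⁻¹ * A) := by
  rw [← matNorm_conjTranspose (A * B⁻¹), Matrix.conjTranspose_mul,
    Matrix.conjTranspose_nonsing_inv, hA.eq, hB.eq]

end Matrices

section Stopping

variable {d n : ℕ}

lemma not_stopBad_of_mem_Fcol (hd : 0 < d) {p l₁ l₂ : ℝ}
    {V : DCube d → Matrix (Fin n) (Fin n) ℂ} {I K : DCube d}
    (hK : K ∈ Fcol (stopST p l₁ l₂ V) I) : ¬stopBad p l₁ l₂ V K I := by
  intro hbad
  obtain ⟨k, ⟨J, hJk, hJI, hJbad, hKJ⟩, hmax⟩ := Int.exists_greatest_of_bdd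
    (P := fun k => ∃ J : DCube d, J.k = k ∧ J.set ⊆ I.set ∧ stopBad p l₁ l₂ V J I ∧ K.set ⊆ J.set)
    ⟨I.k, fun k ⟨J, hJk, hJI, _⟩ => hJk ▸ DCube.level_le_of_subset hd hJI⟩
    ⟨K.k, K, rfl, hK.1, hbad, subset_rfl⟩
  refine hK.2 J ⟨hJI, hJbad, fun L hLI hL hJL => ?_⟩ hKJ
  refine (DCube.eq_of_subset_of_level hJL (le_antisymm (DCube.level_le_of_subset hd hJL) ?_)).symm
  rw [hJk]
  exact hmax _ ⟨L, rfl, hLI, hL, hKJ.trans hJL⟩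

lemma matNorm_mul_inv_le_of_mem_Fcol (hd : 0 < d) {p l₁ a : ℝ} (hp : 1 < p) (ha : 0 ≤ a)
    {V : DCube d → Matrix (Fin n) (Fin n) ℂ} (hV : ∀ J, (V J).PosDef) {I K : DCube d}
    (hK : K ∈ Fcol (stopST p l₁ (a ^ (1 / (p - 1))) V) I) :
    matNorm (V I * (V K)⁻¹) ≤ a ^ (1 / p) := by
  have h := not_stopBad_of_mem_Fcol hd hK
  rw [stopBad, not_or, not_lt, not_lt, ← matNorm_mul_inv_comm (hV I).isHermitian
    (hV K).isHermitian] at h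
  have hq : 0 < p - 1 := by linarith
  have h0 : 0 ≤ matNorm (V I * (V K)⁻¹) := norm_nonneg _
  have h2 := Real.rpow_le_rpow (by positivity) h.2 (z := (p - 1) / p) (by positivity)
  rw [← Real.rpow_mul h0, ← Real.rpow_mul ha] at h2
  have e1 : p / (p - 1) * ((p - 1) / p) = 1 := by field_simp
  have e2 : 1 / (p - 1) * ((p - 1) / p) = 1 / p := by field_simp
  rwa [e1, e2, Real.rpow_one] at h2

end Stopping

section Projection

open DCube

variable {d n : ℕ}

/-- The operator `V_I V_J⁻¹` if `J ∈ S`, and zero otherwise. -/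
def transferOp (V : DCube d → Matrix (Fin n) (Fin n) ℂ) (S : Set (DCube d)) (I J : DCube d) :
    EuclideanSpace ℂ (Fin n) →L[ℂ] EuclideanSpace ℂ (Fin n) :=
  open Classical in
  if J ∈ S then Matrix.toEuclideanCLM (𝕜 := ℂ) (n := Fin n) (V I * (V J)⁻¹) else 0

lemma norm_transferOp_le {V : DCube d → Matrix (Fin n) (Fin n) ℂ} {S : Set (DCube d)}
    {I : DCube d} {Λ : ℝ} (hΛ : 0 ≤ Λ) (h : ∀ J ∈ S, matNorm (V I * (V J)⁻¹) ≤ Λ) (J : DCube d)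
    (v : EuclideanSpace ℂ (Fin n)) : ‖transferOp V S I J v‖ ≤ Λ * ‖v‖ := by
  unfold transferOp
  split_ifs with hJ
  · exact (norm_mApp_le _ v).trans (mul_le_mul_of_nonneg_right (h J hJ) (norm_nonneg _))
  · simpa using mul_nonneg hΛ (norm_nonneg v)

lemma mApp_projInv_eq_sum (hd : 0 < d) (V : DCube d → Matrix (Fin n) (Fin n) ℂ)
    {S : Set (DCube d)} {I : DCube d} (hS : ∀ J ∈ S, J.set ⊆ I.set)
    {f : (Fin d → ℝ) → EuclideanSpace ℂ (Fin n)} (hf : Integrable f) {k₀ : ℤ}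
    (hk₀ : ∀ K : DCube d, K.k ≤ k₀ → ∀ x ∈ K.set, ∀ y ∈ K.set, f x = f y)
    {N : ℕ} (hN : I.k - N ≤ k₀) (x : Fin d → ℝ) :
    mApp (V I) (projInv V S f x) = ∑ j ∈ Finset.range N, transferOp V S I (cubeAt (I.k - j) x)
      (cubeAvg f (cubeAt (I.k - j - 1) x) - cubeAvg f (cubeAt (I.k - j) x)) := by
  classical
  set g : DCube d → EuclideanSpace ℂ (Fin n) := fun J =>
    ∑ ε ∈ Sfin d, haarFn J ε x • mApp ((V J)⁻¹) (haarCoef f J ε) with hg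
  have hg1 : ∀ J, x ∈ J.set →
      g J = mApp ((V J)⁻¹) (cubeAvg f (cubeAt (J.k - 1) x) - cubeAvg f J) := by
    intro J hJ
    obtain ⟨σ, hσ⟩ := cubeAt_sub_one_eq_child J.k x
    rw [mem_set_iff.1 hJ] at hσ
    have hxσ : x ∈ (J.child σ).set := hσ ▸ mem_cubeAt _ x
    rw [hσ, ← sum_haar_eq_cubeAvg_sub hf J hxσ, mApp, map_sum]
    exact Finset.sum_congr rfl fun ε _ => (LinearMap.map_smul_of_tower _ _ _).symm
  have hzero : ∀ J ∉ (Finset.range N).image (fun j : ℕ => cubeAt (I.k - j) x),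
      S.indicator g J = 0 := by
    intro J hJ
    by_cases hJS : J ∈ S
    swap
    · simp [hJS]
    rw [Set.indicator_of_mem hJS]
    by_cases hxJ : x ∈ J.set
    · rw [hg1 J hxJ]
      have hJI := level_le_of_subset hd (hS J hJS)
      have hlev : J.k ≤ k₀ := by
        by_contra hlt
        refine hJ (Finset.mem_image.2 ⟨(I.k - J.k).toNat, Finset.mem_range.2 (by omega), ?_⟩)
        rw [Int.toNat_of_nonneg (by omega), _root_.sub_sub_cancel, mem_set_iff.1 hxJ]
      have h1 : cubeAvg f J = f x := cubeAvg_eq fun y hy => hk₀ J hlev y hy x hxJ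
      have h2 : cubeAvg f (cubeAt (J.k - 1) x) = f x := cubeAvg_eq fun y hy =>
        hk₀ _ (by simp only [cubeAt]; omega) y hy x (mem_cubeAt _ x)
      rw [h1, h2, sub_self, mApp, map_zero]
    · exact Finset.sum_eq_zero fun ε _ => by rw [haarFn_eq_zero ε hxJ, zero_smul]
  have hinj : Set.InjOn (fun j : ℕ => cubeAt (I.k - j) x) (Finset.range N) := by
    intro i _ j _ hij
    have := congrArg DCube.k hij
    simp only [cubeAt] at this
    omega
  have hproj : projInv V S f x = ∑ j ∈ Finset.range N, S.indicator g (cubeAt (I.k - j) x) := by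
    rw [← Finset.sum_image hinj, ← tsum_eq_sum (L := .unconditional _) hzero, ← tsum_subtype S g]
    rfl
  rw [hproj, mApp, map_sum]
  refine Finset.sum_congr rfl fun j _ => ?_
  unfold transferOp
  split_ifs with hjS
  · rw [Set.indicator_of_mem hjS, hg1 _ (mem_cubeAt _ x), map_mul]
    rfl
  · rw [Set.indicator_of_notMem hjS, map_zero, zero_apply]

lemma mApp_projInv_eq_zero (V : DCube d → Matrix (Fin n) (Fin n) ℂ)
    {S : Set (DCube d)} {I : DCube d} (hS : ∀ J ∈ S, J.set ⊆ I.set)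
    (f : (Fin d → ℝ) → EuclideanSpace ℂ (Fin n)) {x : Fin d → ℝ} (hx : x ∉ I.set) :
    mApp (V I) (projInv V S f x) = 0 := by
  have : projInv V S f x = 0 := by
    refine (tsum_congr fun J => Finset.sum_eq_zero fun ε _ => ?_).trans tsum_zero
    rw [haarFn_eq_zero ε fun h => hx (hS J J.2 h), zero_smul]
  rw [this, mApp, map_zero]

/-- The part of a Haar multiplier with uniformly bounded coefficients that lives below a fixed
cube is bounded on `L^p`. -/
lemma exists_lintegral_projInv_le (hd : 0 < d) (n : ℕ) {p : ℝ} (hp : 1 < p) :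
    ∃ C : ℝ, 0 < C ∧ ∀ (V : DCube d → Matrix (Fin n) (Fin n) ℂ) (S : Set (DCube d)) (I : DCube d)
      (f : (Fin d → ℝ) → EuclideanSpace ℂ (Fin n)) (Λ : ℝ), (∀ J ∈ S, J.set ⊆ I.set) →
      FiniteHaar f → 0 ≤ Λ → (∀ J ∈ S, matNorm (V I * (V J)⁻¹) ≤ Λ) →
      ∫⁻ x, ENNReal.ofReal ‖mApp (V I) (projInv V S f x)‖ ^ p ≤
        ENNReal.ofReal C * ENNReal.ofReal (Λ ^ p) * ∫⁻ x, ENNReal.ofReal ‖f x‖ ^ p := by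
  obtain ⟨C, hC, hburk⟩ := exists_descSum_rpow_le d hp
  refine ⟨C, hC, fun V S I f Λ hS hfH hΛ hVΛ => ?_⟩
  have hp0 : 0 < p := by linarith
  have hf := hfH.integrable
  obtain ⟨k₀, hk₀⟩ := hfH.exists_level
  set N := (I.k - k₀).toNat with hNdef
  have hN : I.k - N ≤ k₀ := by omega
  set Y : DCube d → EuclideanSpace ℂ (Fin n) := pathSum I.k fun J K =>
    transferOp V S I J (cubeAvg f K - cubeAvg f J) with hY
  have hdesc : descSum (fun K => ‖Y K‖ ^ p) N I ≤
      C * descSum (fun K => ‖(Λ : ℂ) • cubeAvg f K‖ ^ p) N I := by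
    let := InnerProductSpace.rclikeToReal ℂ (EuclideanSpace ℂ (Fin n))
    refine hburk (EuclideanSpace ℂ (Fin n)) (fun K => (Λ : ℂ) • cubeAvg f K) Y I.k
      (fun J _ => ?_) (fun J hJ => ?_) (fun J hJ σ => ?_) N I le_rfl (by simp [hY, pathSum])
    · simp only [← smul_sub, ← Finset.smul_sum]
      rw [sum_cubeAvg_child_sub hf, smul_zero]
    · simp only [hY, pathSum_child _ hJ]
      rw [← map_sum, sum_cubeAvg_child_sub hf, map_zero]
    · simp only [hY]
      rw [pathSum_child _ hJ, ← smul_sub, norm_smul, Complex.norm_real, Real.norm_of_nonneg hΛ]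
      exact norm_transferOp_le hΛ hVΛ J _
  have hleft : ∫⁻ x in I.set, ENNReal.ofReal ‖mApp (V I) (projInv V S f x)‖ ^ p =
      ENNReal.ofReal (((2 : ℝ) ^ (I.k - N)) ^ d * descSum (fun K => ‖Y K‖ ^ p) N I) := by
    refine setLIntegral_eq_descSum (fun K => by positivity) N I fun K _ hKk x hx => ?_
    rw [ENNReal.ofReal_rpow_of_nonneg (norm_nonneg _) hp0.le,
      mApp_projInv_eq_sum hd V hS hf hk₀ hN x]
    have hlen : (I.k - K.k).toNat = N := by omega
    simp only [hY, pathSum, hlen]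
    rw [Finset.sum_congr rfl fun j hj => ?_]
    have hj' := Finset.mem_range.1 hj
    rw [cubeAt_congr hx K.corner_mem (k := I.k - j) (by omega),
      cubeAt_congr hx K.corner_mem (k := I.k - j - 1) (by omega)]
  have hright : ∫⁻ x in I.set, ENNReal.ofReal ‖f x‖ ^ p =
      ENNReal.ofReal (((2 : ℝ) ^ (I.k - N)) ^ d * descSum (fun K => ‖cubeAvg f K‖ ^ p) N I) := by
    refine setLIntegral_eq_descSum (fun K => by positivity) N I fun K _ hKk x hx => ?_
    rw [ENNReal.ofReal_rpow_of_nonneg (norm_nonneg _) hp0.le,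
      cubeAvg_eq fun y hy => hk₀ K (by omega) y hy x hx]
  have hind : ∫⁻ x, ENNReal.ofReal ‖mApp (V I) (projInv V S f x)‖ ^ p =
      ∫⁻ x in I.set, ENNReal.ofReal ‖mApp (V I) (projInv V S f x)‖ ^ p := by
    rw [← lintegral_indicator I.measurableSet_set]
    refine lintegral_congr fun x => ?_
    by_cases hx : x ∈ I.set
    · rw [Set.indicator_of_mem hx]
    · rw [Set.indicator_of_notMem hx, mApp_projInv_eq_zero V hS f hx, norm_zero,
        ENNReal.ofReal_zero, ENNReal.zero_rpow_of_pos hp0]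
  have hscale : descSum (fun K => ‖(Λ : ℂ) • cubeAvg f K‖ ^ p) N I =
      Λ ^ p * descSum (fun K => ‖cubeAvg f K‖ ^ p) N I := by
    rw [← descSum_const_mul]
    congr 1
    funext K
    rw [norm_smul, Complex.norm_real, Real.norm_of_nonneg hΛ, Real.mul_rpow hΛ (norm_nonneg _)]
  rw [hscale] at hdesc
  calc ∫⁻ x, ENNReal.ofReal ‖mApp (V I) (projInv V S f x)‖ ^ p
      = ENNReal.ofReal (((2 : ℝ) ^ (I.k - N)) ^ d * descSum (fun K => ‖Y K‖ ^ p) N I) :=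
        hind.trans hleft
    _ ≤ ENNReal.ofReal (C * Λ ^ p *
          (((2 : ℝ) ^ (I.k - N)) ^ d * descSum (fun K => ‖cubeAvg f K‖ ^ p) N I)) := by
        refine ENNReal.ofReal_le_ofReal ?_
        refine (mul_le_mul_of_nonneg_left hdesc (by positivity)).trans_eq ?_
        ring
    _ = ENNReal.ofReal C * ENNReal.ofReal (Λ ^ p) *
          ∫⁻ x in I.set, ENNReal.ofReal ‖f x‖ ^ p := by
        rw [hright, ENNReal.ofReal_mul (by positivity), ENNReal.ofReal_mul hC.le]
    _ ≤ ENNReal.ofReal C * ENNReal.ofReal (Λ ^ p) * ∫⁻ x, ENNReal.ofReal ‖f x‖ ^ p :=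
        mul_le_mul_right (setLIntegral_le_lintegral _ _) _

end Projection

/-- With the stopping time `𝒥 = stopST p λ₁ λ₂ V` (with `λ₁` depending
only on `n, d, p` and `λ₂ = C_λ ‖W‖_{A_p}^{p'/p}` as in the decay lemma), and
`M_I f = ∑_{J ∈ ℱ(I)} ∑_{ε ∈ 𝒮} V_J^{-1} f_J^ε h_J^ε`, one has
`‖V_I M_I f‖_{L^p}^p ≤ C ‖W‖_{A_p} ‖f‖_{L^p}^p` for every `f` with finite Haar expansion,
where `C = C(p, n, d)`. -/
theorem statement9 (d n : ℕ) (hd : 0 < d) (hn : 0 < n) (p c₁ c₂ : ℝ)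
    (hp : 1 < p) (hc₁ : 0 < c₁) (hc₂ : 0 < c₂) :
    ∃ l₁ Cl : ℝ, ∃ C : ℝ≥0∞, 1 < l₁ ∧ 0 < Cl ∧ 0 < C ∧ C < ⊤ ∧
      ∀ (W1p : (Fin d → ℝ) → Matrix (Fin n) (Fin n) ℂ)
        (V : DCube d → Matrix (Fin n) (Fin n) ℂ)
        (f : (Fin d → ℝ) → EuclideanSpace ℂ (Fin n)) (I : DCube d),
        MatMeasurable W1p →
        (∀ᵐ x ∂(volume : Measure (Fin d → ℝ)), (W1p x).PosDef) →
        apNorm p W1p < ⊤ →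
        IsReducing p c₁ c₂ W1p V →
        FiniteHaar f →
        ∫⁻ x, ENNReal.ofReal
            ‖mApp (V I)
              (projInv V
                (Fcol (stopST p l₁ (Cl * (apNorm p W1p).toReal ^ (1 / (p - 1))) V) I)
                f x)‖ ^ p ≤
          C * apNorm p W1p * ∫⁻ x, ENNReal.ofReal ‖f x‖ ^ p := by
  have hp0 : 0 < p := by linarith
  obtain ⟨C, hC, h⟩ := exists_lintegral_projInv_le hd n hp
  refine ⟨2, 1, ENNReal.ofReal C, by norm_num, zero_lt_one, ENNReal.ofReal_pos.2 hC,
    ENNReal.ofReal_lt_top, fun W1p V f I _ _ hA hV hf => ?_⟩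
  have ha : 0 ≤ (apNorm p W1p).toReal := ENNReal.toReal_nonneg
  rw [one_mul]
  refine (h V _ I f ((apNorm p W1p).toReal ^ (1 / p)) (fun J hJ => hJ.1) hf (by positivity)
    fun J hJ => matNorm_mul_inv_le_of_mem_Fcol hd hp ha (fun K => (hV K).1) hJ).trans_eq ?_
  rw [← Real.rpow_mul ha, one_div_mul_cancel hp0.ne', Real.rpow_one,
    ENNReal.ofReal_toReal hA.ne]

end
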